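/- arXiv:2001.10604 — 2 statements merged into one kernel-verified Lean document; each statement's English description precedes it below -/
import Mathlib

section
/- Let s > 1/2 and let f, g : ℝ → ℂ be continuous 2π-periodic functions with ‖f‖_s < ∞ and ‖g‖_s < ∞. Then the periodic trapezoidal quadrature error for their L² inner product satisfies |⟨f,g⟩_{L²} − (2π/(2M+1)) Σ_{|m|≤M} f(θ_m) · conj(g(θ_m))| ≤ (2 C_s + C_s²) (1/2 + M)^{−s} ‖f‖_s ‖g‖_s. -/
open Complex Real

/-- Equidistant interpolation nodes `θ_m = 2πm/(2M+1)`. -/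
noncomputable def theta (M : ℕ) (m : ℤ) : ℝ := 2 * Real.pi * m / (2 * M + 1)

/-- Trigonometric interpolation basis function
`φ_m(θ) = (1/(2M+1)) Σ_{|n|≤M} e^{i n (θ - θ_m)}`. -/
noncomputable def phi (M : ℕ) (m : ℤ) (θ : ℝ) : ℂ :=
  (1 / (2 * (M : ℂ) + 1)) * ∑ n ∈ Finset.Icc (-(M : ℤ)) (M : ℤ),
    Complex.exp (Complex.I * (n : ℂ) * ((θ - theta M m : ℝ) : ℂ))

/-- The `L²(-π,π)` inner product of two (2π-periodic) functions. -/
noncomputable def L2inner (f g : ℝ → ℂ) : ℂ :=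
  ∫ θ in (-Real.pi)..Real.pi, f θ * (starRingEnd ℂ) (g θ)

/-- Trigonometric interpolation operator `Q_M g = Σ_{|m|≤M} g(θ_m) φ_m`. -/
noncomputable def QM (M : ℕ) (g : ℝ → ℂ) : ℝ → ℂ :=
  fun θ => ∑ m ∈ Finset.Icc (-(M : ℤ)) (M : ℤ), g (theta M m) * phi M m θ

/-- Fourier coefficient `ĝ(n) = (1/(2π)) ∫_{-π}^{π} g(θ) e^{-inθ} dθ`. -/
noncomputable def fCoeff (g : ℝ → ℂ) (n : ℤ) : ℂ :=
  (1 / (2 * (Real.pi : ℂ))) *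
    ∫ θ in (-Real.pi)..Real.pi, g θ * Complex.exp (-(Complex.I * (n : ℂ) * (θ : ℂ)))

/-- The periodic Sobolev norm `‖g‖_s = (2π Σ_{n∈ℤ} max(1,|n|)^{2s} |ĝ(n)|²)^{1/2}`. -/
noncomputable def sobNorm (s : ℝ) (g : ℝ → ℂ) : ℝ :=
  Real.sqrt (2 * Real.pi * ∑' n : ℤ, (max 1 |(n : ℝ)|) ^ (2 * s) * ‖fCoeff g n‖ ^ 2)

/-- `‖g‖_s < ∞`, expressed as summability of the weighted squared Fourier coefficients. -/
def SobSummable (s : ℝ) (g : ℝ → ℂ) : Prop :=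
  Summable (fun n : ℤ => (max 1 |(n : ℝ)|) ^ (2 * s) * ‖fCoeff g n‖ ^ 2)

/-- The constant `C_s = (Σ_{n≥0} max(1,n)^{-2s})^{1/2}`. -/
noncomputable def Cs (s : ℝ) : ℝ := Real.sqrt (∑' n : ℕ, (max 1 (n : ℝ)) ^ (-(2 * s)))

namespace Aux

lemma cs_tsum {ι : Type*} {u v : ι → ℝ} (hu : ∀ i, 0 ≤ u i) (hv : ∀ i, 0 ≤ v i)
    (su : Summable fun i => u i ^ 2) (sv : Summable fun i => v i ^ 2) :
    (Summable fun i => u i * v i) ∧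
      ∑' i, u i * v i ≤ Real.sqrt (∑' i, u i ^ 2) * Real.sqrt (∑' i, v i ^ 2) := by
  have h := Real.summable_and_inner_le_Lp_mul_Lq_tsum_of_nonneg
    (p := 2) (q := 2) (f := u) (g := v) Real.HolderConjugate.two_two hu hv
    (by simpa using su) (by simpa using sv)
  refine ⟨h.1, ?_⟩
  simpa [Real.sqrt_eq_rpow] using h.2

noncomputable def wt (n : ℤ) : ℝ := max 1 |(n : ℝ)|

lemma wt_pos (n : ℤ) : 0 < wt n := lt_of_lt_of_le one_pos (le_max_left _ _)
lemma one_le_wt (n : ℤ) : 1 ≤ wt n := le_max_left _ _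

lemma summable_nat_wt {s : ℝ} (hs : 1 / 2 < s) :
    Summable fun n : ℕ => (max 1 (n : ℝ)) ^ (-(2 * s)) := by
  rw [← summable_nat_add_iff 1]
  have h : Summable fun n : ℕ => ((n : ℝ)) ^ (-(2 * s)) :=
    Real.summable_nat_rpow.2 (by linarith)
  refine ((summable_nat_add_iff 1).2 h).congr fun n => ?_
  rw [max_eq_right]
  push_cast
  linarith [(Nat.cast_nonneg n : (0:ℝ) ≤ n)]

def idx (M : ℕ) (r : Fin (2 * M + 1)) (l : ℤ) : ℤ := (r : ℤ) - M + l * (2 * M + 1)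

lemma idx_bij (M : ℕ) : Function.Bijective (fun p : Fin (2 * M + 1) × ℤ => idx M p.1 p.2) := by
  have h := ((Equiv.prodComm _ _).trans (Int.divModEquiv (2 * M + 1)).symm).trans
    (Equiv.addRight (-(M:ℤ))) |>.bijective
  convert h using 1
  funext p
  simp [idx, Int.divModEquiv]
  ring

lemma hasSum_split {E : Type*} [NormedAddCommGroup E] [CompleteSpace E] (M : ℕ) {F : ℤ → E}
    (hF : Summable F) :
    (∀ r, Summable fun l => F (idx M r l)) ∧ ∑' n, F n = ∑ r, ∑' l, F (idx M r l) := by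
  let e := Equiv.ofBijective _ (idx_bij M)
  have h1 : Summable (fun p : Fin (2 * M + 1) × ℤ => F (idx M p.1 p.2)) :=
    (e.summable_iff (f := F)).2 hF
  refine ⟨fun r => h1.prod_factor r, ?_⟩
  have h2 : ∑' p : Fin (2 * M + 1) × ℤ, F (idx M p.1 p.2) = ∑' n, F n := e.tsum_eq F
  rw [← h2, h1.tsum_prod, tsum_fintype]

/-- injection of the nonzero integers into the naturals -/
def inj (l : ℤ) : ℕ := if 0 < l then (2 * l - 1).toNat else (-2 * l - 2).toNat

lemma inj_inj : Function.Injective (fun l : {l : ℤ // l ≠ 0} => inj l) := by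
  rintro ⟨a, ha⟩ ⟨b, hb⟩ h
  simp only [inj] at h
  ext
  simp only
  split_ifs at h <;> omega

lemma wt_idx (M : ℕ) (hM : 1 ≤ M) (r : Fin (2 * M + 1)) (l : ℤ) (hl : l ≠ 0) :
    (1 / 2 + (M : ℝ)) * max 1 (inj l : ℝ) ≤ wt (idx M r l) := by
  have hr := r.2
  have key : (2 * (M : ℤ) + 1) * max 1 (inj l : ℤ) ≤ 2 * |idx M r l| := by
    have h1 : max 1 (inj l : ℤ) ≤ 2 * |l| - 1 := by
      simp only [inj]
      rcases lt_or_gt_of_ne hl with h | h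
      · rw [abs_of_neg h]; split_ifs <;> omega
      · rw [abs_of_pos h]; split_ifs <;> omega
    have h2 : (2 * (M : ℤ) + 1) * max 1 (inj l : ℤ) ≤ (2 * M + 1) * (2 * |l| - 1) := by
      gcongr
    refine h2.trans ?_
    have h3 : |l * (2 * (M : ℤ) + 1)| ≤ |idx M r l| + |(r : ℤ) - M| := by
      have := abs_sub (idx M r l) ((r : ℤ) - M)
      refine le_trans (le_of_eq ?_) this
      congr 1; simp [idx]
    have h4 : |(r : ℤ) - M| ≤ M := by rw [abs_le]; omega
    rw [abs_mul, abs_of_nonneg (by positivity : (0:ℤ) ≤ 2 * (M : ℤ) + 1)] at h3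
    nlinarith
  have key' : (2 * (M : ℝ) + 1) * max 1 (inj l : ℝ) ≤ 2 * |(idx M r l : ℝ)| := by
    exact_mod_cast key
  refine le_trans ?_ (le_max_right _ _)
  linarith

lemma class_sum (M : ℕ) (hM : 1 ≤ M) {s : ℝ} (hs : 1 / 2 < s) (r : Fin (2 * M + 1)) :
    (Summable fun l : {l : ℤ // l ≠ 0} => (wt (idx M r l) ^ (-s)) ^ 2) ∧
    Real.sqrt (∑' l : {l : ℤ // l ≠ 0}, (wt (idx M r l) ^ (-s)) ^ 2)
      ≤ (1 / 2 + (M : ℝ)) ^ (-s) * Cs s := by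
  have hh : (0:ℝ) < 1 / 2 + (M : ℝ) := by positivity
  have hb : ∀ l : {l : ℤ // l ≠ 0}, (wt (idx M r l) ^ (-s)) ^ 2 ≤
      ((1 / 2 + (M : ℝ)) ^ (-s)) ^ 2 * (max 1 (inj l : ℝ)) ^ (-(2 * s)) := by
    intro l
    have hm : (0:ℝ) < max 1 (inj l : ℝ) := lt_of_lt_of_le one_pos (le_max_left _ _)
    have h1 : wt (idx M r l) ^ (-s) ≤ ((1 / 2 + (M : ℝ)) * max 1 (inj l : ℝ)) ^ (-s) :=
      Real.rpow_le_rpow_of_nonpos (by positivity) (wt_idx M hM r l l.2) (by linarith)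
    rw [Real.mul_rpow hh.le hm.le] at h1
    have h2 : (max 1 (inj l : ℝ)) ^ (-(2 * s)) = ((max 1 (inj l : ℝ)) ^ (-s)) ^ 2 := by
      rw [← Real.rpow_natCast, ← Real.rpow_mul hm.le]; congr 1; push_cast; ring
    rw [h2, ← mul_pow]
    have := Real.rpow_nonneg (wt_pos (idx M r l)).le (-s)
    gcongr
  have hn := (summable_nat_wt hs).mul_left (((1 / 2 + (M : ℝ)) ^ (-s)) ^ 2)
  have hs1 : Summable fun l : {l : ℤ // l ≠ 0} =>
      ((1 / 2 + (M : ℝ)) ^ (-s)) ^ 2 * (max 1 (inj l : ℝ)) ^ (-(2 * s)) :=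
    hn.comp_injective inj_inj
  have hs2 : Summable fun l : {l : ℤ // l ≠ 0} => (wt (idx M r l) ^ (-s)) ^ 2 :=
    Summable.of_nonneg_of_le (fun _ => sq_nonneg _) hb hs1
  refine ⟨hs2, ?_⟩
  have h3 := Summable.tsum_le_tsum_of_inj
    (f := fun l : {l : ℤ // l ≠ 0} => (wt (idx M r l) ^ (-s)) ^ 2)
    (g := fun n : ℕ => ((1 / 2 + (M : ℝ)) ^ (-s)) ^ 2 * (max 1 (n : ℝ)) ^ (-(2 * s)))
    (fun l : {l : ℤ // l ≠ 0} => inj l) inj_inj (fun c _ => by positivity) hb hs2 hn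
  rw [tsum_mul_left] at h3
  refine (Real.sqrt_le_sqrt h3).trans ?_
  rw [Real.sqrt_mul (sq_nonneg _), Real.sqrt_sq (by positivity), Cs]

/-- class norm -/
noncomputable def cn (M : ℕ) (s : ℝ) (a : ℤ → ℂ) (r : Fin (2 * M + 1)) : ℝ :=
  ∑' l, wt (idx M r l) ^ (2 * s) * ‖a (idx M r l)‖ ^ 2

lemma wt_sq (s : ℝ) (n : ℤ) : wt n ^ (2 * s) = (wt n ^ s) ^ 2 := by
  rw [← Real.rpow_natCast, ← Real.rpow_mul (wt_pos n).le]; congr 1; push_cast; ring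

lemma wt_cancel (s : ℝ) (n : ℤ) (x : ℝ) : wt n ^ (-s) * (wt n ^ s * x) = x := by
  rw [← mul_assoc, ← Real.rpow_add (wt_pos n)]; simp

lemma class_bound (M : ℕ) (hM : 1 ≤ M) {s : ℝ} (hs : 1 / 2 < s) (a : ℤ → ℂ)
    (ha : Summable fun n => wt n ^ (2 * s) * ‖a n‖ ^ 2) (r : Fin (2 * M + 1)) :
    (Summable fun l => ‖a (idx M r l)‖) ∧
    ‖a (idx M r 0)‖ ≤ Real.sqrt (cn M s a r) ∧
    ∑' l, ‖a (idx M r l)‖ ≤ ‖a (idx M r 0)‖ +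
      (1 / 2 + (M : ℝ)) ^ (-s) * Cs s * Real.sqrt (cn M s a r) := by
  have hc := (hasSum_split M ha).1 r
  have hnn : ∀ l, 0 ≤ wt (idx M r l) ^ (2 * s) * ‖a (idx M r l)‖ ^ 2 := fun l =>
    mul_nonneg (Real.rpow_nonneg (wt_pos _).le _) (sq_nonneg _)
  have heq : ∀ n, wt n ^ (2 * s) * ‖a n‖ ^ 2 = (wt n ^ s * ‖a n‖) ^ 2 := fun n => by
    rw [wt_sq, mul_pow]
  have hc' : Summable fun l : {l : ℤ // l ≠ 0} =>
      (wt (idx M r l) ^ s * ‖a (idx M r l)‖) ^ 2 := by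
    have := hc.comp_injective (Subtype.coe_injective (p := fun l : ℤ => l ≠ 0))
    exact this.congr fun l => (heq _)
  obtain ⟨hs2, hle⟩ := class_sum M hM hs r
  obtain ⟨h1, h2⟩ := cs_tsum (u := fun l : {l : ℤ // l ≠ 0} => wt (idx M r l) ^ (-s))
    (v := fun l : {l : ℤ // l ≠ 0} => wt (idx M r l) ^ s * ‖a (idx M r l)‖)
    (fun l => Real.rpow_nonneg (wt_pos _).le _)
    (fun l => mul_nonneg (Real.rpow_nonneg (wt_pos _).le _) (norm_nonneg _)) hs2 hc'
  simp only [wt_cancel] at h1 h2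
  have hsum : Summable fun l => ‖a (idx M r l)‖ := by
    rw [← (Finset.summable_compl_iff ({0} : Finset ℤ))]
    refine (Equiv.summable_iff (Equiv.subtypeEquivRight (p := fun l : ℤ => l ≠ 0)
      (q := fun l : ℤ => l ∉ ({0} : Finset ℤ)) (by simp))).1 ?_
    exact h1
  refine ⟨hsum, ?_, ?_⟩
  · apply Real.le_sqrt_of_sq_le
    refine le_trans ?_ (hc.le_tsum 0 (fun l _ => hnn l))
    have : 1 ≤ wt (idx M r 0) ^ (2 * s) := Real.one_le_rpow (one_le_wt _) (by linarith)
    nlinarith [sq_nonneg ‖a (idx M r 0)‖]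
  · have h3 : ∑' l, ‖a (idx M r l)‖ = ‖a (idx M r 0)‖ +
        ∑' l : {l : ℤ // l ≠ 0}, ‖a (idx M r l)‖ := by
      have := hsum.sum_add_tsum_subtype_compl ({0} : Finset ℤ)
      rw [← this, Finset.sum_singleton]
      congr 1
      exact (Equiv.tsum_eq (Equiv.subtypeEquivRight (p := fun l : ℤ => l ≠ 0)
        (q := fun l : ℤ => l ∉ ({0} : Finset ℤ)) (by simp)) (fun l => ‖a (idx M r l)‖)).symm
    rw [h3]
    have h4 : ∑' l : {l : ℤ // l ≠ 0}, (wt (idx M r l) ^ s * ‖a (idx M r l)‖) ^ 2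
        ≤ cn M s a r :=
      Summable.tsum_le_tsum_of_inj (fun l : {l : ℤ // l ≠ 0} => (l : ℤ))
        Subtype.coe_injective (fun c _ => hnn c) (fun l => (heq _).ge) hc' hc
    gcongr
    refine h2.trans ?_
    have : 0 ≤ (1 / 2 + (M : ℝ)) ^ (-s) * Cs s := (Real.sqrt_nonneg _).trans hle
    gcongr

lemma diag_bound {a b : ℤ → ℂ} (ha : Summable fun l => ‖a l‖) (hb : Summable fun l => ‖b l‖) :
    ‖∑' l, a l * (starRingEnd ℂ) (b l) - (∑' l, a l) * (starRingEnd ℂ) (∑' l, b l)‖ ≤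
      (∑' l, ‖a l‖) * (∑' l, ‖b l‖) - ‖a 0‖ * ‖b 0‖ := by
  have hb1 : ∀ l, ‖b l - ∑' k, b k‖ ≤ (∑' k, ‖b k‖) - ‖b l‖ := by
    intro l
    have e1 := hb.of_norm.tsum_eq_add_tsum_ite l
    have e2 := hb.tsum_eq_add_tsum_ite l
    rw [e1, e2]
    simp only [sub_add_cancel_left, norm_neg, add_sub_cancel_left]
    have hs : Summable fun k => ‖if k = l then (0:ℂ) else b k‖ :=
      Summable.of_nonneg_of_le (fun _ => norm_nonneg _)
        (fun k => by split_ifs <;> simp) hb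
    refine (norm_tsum_le_tsum_norm hs).trans (le_of_eq ?_)
    congr 1; funext k; split_ifs <;> simp
  have hbd : ∀ l, ‖b l‖ ≤ ∑' k, ‖b k‖ := fun l => hb.le_tsum l (fun _ _ => norm_nonneg _)
  have sab : Summable fun l => ‖a l‖ * ‖b l‖ :=
    Summable.of_nonneg_of_le (fun _ => by positivity)
      (fun l => mul_le_mul_of_nonneg_left (hbd l) (norm_nonneg _)) (ha.mul_right _)
  have sab' : Summable fun l => a l * (starRingEnd ℂ) (b l) :=
    Summable.of_norm (by simpa using sab)
  have s1 : Summable fun l => ‖a l‖ * ((∑' k, ‖b k‖) - ‖b l‖) := by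
    simp only [mul_sub]
    exact (ha.mul_right _).sub sab
  have hle : ∀ l, ‖a l * (starRingEnd ℂ) (b l) - a l * (starRingEnd ℂ) (∑' l, b l)‖ ≤
      ‖a l‖ * ((∑' k, ‖b k‖) - ‖b l‖) := by
    intro l
    rw [← mul_sub, ← map_sub, norm_mul, RCLike.norm_conj]
    exact mul_le_mul_of_nonneg_left (hb1 l) (norm_nonneg _)
  rw [← tsum_mul_right, ← sab'.tsum_sub (ha.of_norm.mul_right _)]
  refine (tsum_of_norm_bounded s1.hasSum hle).trans ?_
  simp only [mul_sub]
  rw [(ha.mul_right _).tsum_sub sab, tsum_mul_right]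
  gcongr
  exact sab.le_tsum 0 (fun _ _ => by positivity)

end Aux
namespace Aux

lemma summable_norm_all (M : ℕ) (hM : 1 ≤ M) {s : ℝ} (hs : 1 / 2 < s) (a : ℤ → ℂ)
    (ha : Summable fun n => wt n ^ (2 * s) * ‖a n‖ ^ 2) : Summable fun n => ‖a n‖ := by
  let e := Equiv.ofBijective _ (idx_bij M)
  refine (e.summable_iff (f := fun n => ‖a n‖)).1 ?_
  refine (summable_prod_of_nonneg (f := fun p : Fin (2 * M + 1) × ℤ => ‖a (idx M p.1 p.2)‖)
    (fun _ => norm_nonneg _)).2 ⟨fun r => (class_bound M hM hs a ha r).1, ?_⟩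
  exact (hasSum_fintype _).summable

lemma fourier_hasSum (f : ℝ → ℂ) (hc : Continuous f) (hp : Function.Periodic f (2 * Real.pi))
    (hsum : Summable fun n => ‖fCoeff f n‖) (x : ℝ) :
    HasSum (fun n : ℤ => fCoeff f n * Complex.exp (Complex.I * n * x)) (f x) := by
  have : Fact (0 < 2 * Real.pi) := ⟨by positivity⟩
  let F : C(AddCircle (2 * Real.pi), ℂ) := ⟨hp.lift, continuous_coinduced_dom.mpr hc⟩
  have hF : ∀ y : ℝ, F (y : AddCircle (2 * Real.pi)) = f y := fun y => rfl
  have hpi : (Real.pi : ℂ) ≠ 0 := by exact_mod_cast Real.pi_ne_zero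
  have hco : ∀ n, fourierCoeff F n = fCoeff f n := by
    intro n
    rw [fourierCoeff_eq_intervalIntegral F n (-Real.pi), fCoeff]
    rw [show -Real.pi + 2 * Real.pi = Real.pi by ring]
    rw [Complex.real_smul]
    push_cast
    congr 1
    apply intervalIntegral.integral_congr
    intro y _
    simp only [hF, fourier_coe_apply, smul_eq_mul]
    rw [mul_comm]
    congr 2
    push_cast
    field_simp
  have h := has_pointwise_sum_fourier_series_of_summable (f := F)
    (by simpa only [funext hco] using hsum.of_norm) (x : AddCircle (2 * Real.pi))
  rw [hF] at h
  convert h using 1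
  funext n
  symm
  rw [hco, fourier_coe_apply, smul_eq_mul]
  congr 2
  push_cast
  field_simp

lemma hasSum_swap {u v : ℤ → ℂ} {x : ℂ} (h : HasSum u x) (e : ∀ n, u n = v n) :
    HasSum v x := (funext e : u = v) ▸ h

lemma L2_hasSum (f g : ℝ → ℂ) (hfc : Continuous f) 
    (hgc : Continuous g) (hgp : Function.Periodic g (2 * Real.pi))
    (hsum : Summable fun n => ‖fCoeff g n‖) :
    HasSum (fun n : ℤ => (2 * Real.pi : ℂ) * (fCoeff f n * (starRingEnd ℂ) (fCoeff g n)))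
      (L2inner f g) := by
  have hpi : (Real.pi : ℂ) ≠ 0 := by exact_mod_cast Real.pi_ne_zero
  have h := intervalIntegral.hasSum_integral_of_dominated_convergence
    (μ := MeasureTheory.volume) (a := -Real.pi) (b := Real.pi)
    (F := fun (n : ℤ) t => f t *
      (starRingEnd ℂ) (fCoeff g n * Complex.exp (Complex.I * n * t)))
    (f := fun t => f t * (starRingEnd ℂ) (g t))
    (fun n t => ‖f t‖ * ‖fCoeff g n‖)
    (fun n => Continuous.aestronglyMeasurable (by fun_prop))
    (fun n => Filter.Eventually.of_forall fun t _ => by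
      have : ‖Complex.exp (Complex.I * n * t)‖ = 1 := by
        rw [show Complex.I * n * t = ((n * t : ℝ) : ℂ) * Complex.I by push_cast; ring]
        exact Complex.norm_exp_ofReal_mul_I _
      simp [this])
    (Filter.Eventually.of_forall fun t _ => hsum.mul_left _)
    (by
      simp only [tsum_mul_left]
      apply Continuous.intervalIntegrable
      fun_prop)
    (Filter.Eventually.of_forall fun t _ => 
      (((fourier_hasSum g hgc hgp hsum t).map (starRingEnd ℂ) Complex.continuous_conj)).mul_left _)
  refine hasSum_swap h fun n => ?_
  have : ∀ t : ℝ, f t * (starRingEnd ℂ) (fCoeff g n * Complex.exp (Complex.I * n * t)) =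
      (starRingEnd ℂ) (fCoeff g n) * (f t * Complex.exp (-(Complex.I * n * t))) := by
    intro t
    rw [map_mul, ← Complex.exp_conj]
    simp only [map_mul, Complex.conj_I, Complex.conj_ofReal, map_intCast, neg_mul]
    ring
  simp only [this]
  rw [intervalIntegral.integral_const_mul]
  generalize (starRingEnd ℂ) (fCoeff g n) = c
  rw [fCoeff]
  field_simp

lemma orth (M : ℕ) (r r' : Fin (2 * M + 1)) :
    ∑ m ∈ Finset.Icc (-(M : ℤ)) (M : ℤ),
      Complex.exp (Complex.I * ((r : ℤ) - (M : ℤ) : ℤ) * theta M m) *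
      (starRingEnd ℂ) (Complex.exp (Complex.I * ((r' : ℤ) - (M : ℤ) : ℤ) * theta M m)) =
      if r = r' then (2 * M + 1 : ℂ) else 0 := by
  have hN : (2 * (M : ℂ) + 1) ≠ 0 := by exact_mod_cast (by omega : 2 * M + 1 ≠ 0)
  set z : ℂ := Complex.exp (2 * Real.pi * Complex.I * ((r : ℤ) - (r' : ℤ) : ℤ) / (2 * M + 1)) with hz
  have hterm : ∀ m : ℤ, Complex.exp (Complex.I * ((r : ℤ) - (M : ℤ) : ℤ) * theta M m) *
      (starRingEnd ℂ) (Complex.exp (Complex.I * ((r' : ℤ) - (M : ℤ) : ℤ) * theta M m)) =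
      z ^ m := by
    intro m
    rw [hz, ← Complex.exp_int_mul, ← Complex.exp_conj, ← Complex.exp_add]
    congr 1
    simp only [map_mul, Complex.conj_I, Complex.conj_ofReal, map_intCast, theta]
    push_cast
    field_simp
    ring
  simp only [hterm]
  split_ifs with h
  · subst h
    simp [hz]
    have : ((M : ℤ) + 1 + M).toNat = 2 * M + 1 := by omega
    rw [this]; push_cast; ring
  · have hz1 : z ≠ 1 := by
      rw [hz, Ne, Complex.exp_eq_one_iff]
      rintro ⟨n, hn⟩
      have hI : (2 * Real.pi * Complex.I : ℂ) ≠ 0 := Complex.two_pi_I_ne_zero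
      have h2 : (((r : ℤ) - (r' : ℤ) : ℤ) : ℂ) = n * (2 * M + 1) := by
        have : (2 * Real.pi * Complex.I : ℂ) * (((r : ℤ) - (r' : ℤ) : ℤ) : ℂ) =
            (2 * Real.pi * Complex.I : ℂ) * (n * (2 * M + 1)) := by
          rw [div_eq_iff hN] at hn
          rw [hn]; ring
        exact mul_left_cancel₀ hI this
      have h3 : (r : ℤ) - (r' : ℤ) = n * (2 * M + 1) := by exact_mod_cast h2
      have hr := r.2
      have hr' := r'.2
      have hne : (r : ℤ) ≠ r' := fun hh => h (Fin.ext (by exact_mod_cast hh))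
      have : n ≠ 0 := by rintro rfl; apply hne; linarith
      rcases lt_or_gt_of_ne this with h5 | h5
      · have : n ≤ -1 := by omega
        nlinarith
      · have : 1 ≤ n := by omega
        nlinarith
    have hz0 : z ≠ 0 := Complex.exp_ne_zero _
    have hzN : z ^ (2 * M + 1) = 1 := by
      rw [hz, ← Complex.exp_nat_mul, Complex.exp_eq_one_iff]
      refine ⟨(r : ℤ) - (r' : ℤ), ?_⟩
      push_cast
      field_simp
    have himg : Finset.Icc (-(M : ℤ)) (M : ℤ) =
        (Finset.range (2 * M + 1)).image (fun j : ℕ => (j : ℤ) - M) := by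
      ext m
      simp only [Finset.mem_Icc, Finset.mem_image, Finset.mem_range]
      constructor
      · rintro ⟨h1, h2⟩
        exact ⟨(m + M).toNat, by omega, by omega⟩
      · rintro ⟨j, h1, h2⟩
        omega
    rw [himg, Finset.sum_image (by intro a _ b _ hab; simpa using hab)]
    simp only [zpow_sub₀ hz0, zpow_natCast]
    rw [← Finset.sum_div, geom_sum_eq hz1, hzN]
    simp

lemma f_theta (M : ℕ) (f : ℝ → ℂ) (hc : Continuous f) (hp : Function.Periodic f (2 * Real.pi))
    (hsum : Summable fun n => ‖fCoeff f n‖) (m : ℤ) :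
    f (theta M m) = ∑ r : Fin (2 * M + 1), (∑' l, fCoeff f (idx M r l)) *
      Complex.exp (Complex.I * ((r : ℤ) - (M : ℤ) : ℤ) * theta M m) := by
  have hN : (2 * (M : ℂ) + 1) ≠ 0 := by exact_mod_cast (by omega : 2 * M + 1 ≠ 0)
  have h := fourier_hasSum f hc hp hsum (theta M m)
  rw [← h.tsum_eq, (hasSum_split M h.summable).2]
  refine Finset.sum_congr rfl fun r _ => ?_
  rw [← tsum_mul_right]
  congr 1
  funext l
  congr 1
  rw [Complex.exp_eq_exp_iff_exists_int]
  refine ⟨l * m, ?_⟩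
  have ht : ((theta M m : ℝ) : ℂ) * (2 * M + 1) = 2 * Real.pi * m := by
    simp only [theta]
    push_cast
    rw [div_mul_cancel₀ _ hN]
  simp only [idx]
  push_cast
  linear_combination (Complex.I * l) * ht

lemma quad (M : ℕ) (f g : ℝ → ℂ) (hfc : Continuous f) (hfp : Function.Periodic f (2 * Real.pi))
    (hf : Summable fun n => ‖fCoeff f n‖)
    (hgc : Continuous g) (hgp : Function.Periodic g (2 * Real.pi))
    (hg : Summable fun n => ‖fCoeff g n‖) :
    ∑ m ∈ Finset.Icc (-(M : ℤ)) (M : ℤ), f (theta M m) * (starRingEnd ℂ) (g (theta M m)) =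
    (2 * M + 1 : ℂ) * ∑ r : Fin (2 * M + 1), (∑' l, fCoeff f (idx M r l)) *
      (starRingEnd ℂ) (∑' l, fCoeff g (idx M r l)) := by
  set α := fun r : Fin (2 * M + 1) => ∑' l, fCoeff f (idx M r l)
  set β := fun r : Fin (2 * M + 1) => ∑' l, fCoeff g (idx M r l)
  set E := fun (r : Fin (2 * M + 1)) (m : ℤ) =>
    Complex.exp (Complex.I * ((r : ℤ) - (M : ℤ) : ℤ) * theta M m) with hE
  have h1 : ∀ m, f (theta M m) = ∑ r, α r * E r m := fun m => f_theta M f hfc hfp hf m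
  have h2 : ∀ m, g (theta M m) = ∑ r, β r * E r m := fun m => f_theta M g hgc hgp hg m
  have ho : ∀ r r', ∑ m ∈ Finset.Icc (-(M : ℤ)) (M : ℤ), E r m * (starRingEnd ℂ) (E r' m) =
      if r = r' then (2 * M + 1 : ℂ) else 0 := orth M
  calc _ = ∑ m ∈ Finset.Icc (-(M : ℤ)) (M : ℤ), ∑ r, ∑ r',
        α r * (starRingEnd ℂ) (β r') * (E r m * (starRingEnd ℂ) (E r' m)) := by
        refine Finset.sum_congr rfl fun m _ => ?_
        rw [h1, h2, map_sum, Finset.sum_mul_sum]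
        refine Finset.sum_congr rfl fun r _ => Finset.sum_congr rfl fun r' _ => ?_
        rw [map_mul]; ring
    _ = ∑ r, ∑ r', α r * (starRingEnd ℂ) (β r') *
        ∑ m ∈ Finset.Icc (-(M : ℤ)) (M : ℤ), (E r m * (starRingEnd ℂ) (E r' m)) := by
        rw [Finset.sum_comm]
        refine Finset.sum_congr rfl fun r _ => ?_
        rw [Finset.sum_comm]
        refine Finset.sum_congr rfl fun r' _ => ?_
        rw [Finset.mul_sum]
    _ = _ := by
        simp only [ho, mul_ite, mul_zero, Finset.sum_ite_eq, Finset.mem_univ, if_true]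
        rw [Finset.mul_sum]
        exact Finset.sum_congr rfl fun r _ => mul_comm _ _

end Aux

/-- Quadrature error estimate: for `s > 1/2` and continuous
2π-periodic `f, g` with finite `s`-Sobolev norms,
`|⟨f,g⟩_{L²} - (2π/(2M+1)) Σ f(θ_m) conj(g(θ_m))| ≤ (2C_s + C_s²)(1/2+M)^{-s} ‖f‖_s ‖g‖_s`. -/
theorem stmt_11 (M : ℕ) (hM : 1 ≤ M) (s : ℝ) (hs : 1 / 2 < s) (f g : ℝ → ℂ)
    (hfc : Continuous f) (hfp : Function.Periodic f (2 * Real.pi)) (hfs : SobSummable s f)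
    (hgc : Continuous g) (hgp : Function.Periodic g (2 * Real.pi)) (hgs : SobSummable s g) :
    ‖L2inner f g - ((2 * Real.pi / (2 * M + 1) : ℝ) : ℂ) *
        ∑ m ∈ Finset.Icc (-(M : ℤ)) (M : ℤ),
          f (theta M m) * (starRingEnd ℂ) (g (theta M m))‖ ≤
      (2 * Cs s + Cs s ^ 2) * (1 / 2 + (M : ℝ)) ^ (-s) * sobNorm s f * sobNorm s g := by
  have hfs' : Summable fun n : ℤ => Aux.wt n ^ (2 * s) * ‖fCoeff f n‖ ^ 2 := hfs
  have hgs' : Summable fun n : ℤ => Aux.wt n ^ (2 * s) * ‖fCoeff g n‖ ^ 2 := hgs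
  have hf := Aux.summable_norm_all M hM hs _ hfs'
  have hg := Aux.summable_norm_all M hM hs _ hgs'
  have hL := Aux.L2_hasSum f g hfc hgc hgp hg
  have hpi : (Real.pi : ℂ) ≠ 0 := by exact_mod_cast Real.pi_ne_zero
  have hN : (2 * (M : ℂ) + 1) ≠ 0 := by exact_mod_cast (by omega : 2 * M + 1 ≠ 0)
  have hdiff : L2inner f g - ((2 * Real.pi / (2 * M + 1) : ℝ) : ℂ) *
        ∑ m ∈ Finset.Icc (-(M : ℤ)) (M : ℤ),
          f (theta M m) * (starRingEnd ℂ) (g (theta M m)) =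
      (2 * Real.pi : ℝ) * ∑ r : Fin (2 * M + 1),
        ((∑' l, fCoeff f (Aux.idx M r l) * (starRingEnd ℂ) (fCoeff g (Aux.idx M r l))) -
        (∑' l, fCoeff f (Aux.idx M r l)) * (starRingEnd ℂ) (∑' l, fCoeff g (Aux.idx M r l))) := by
    rw [Aux.quad M f g hfc hfp hf hgc hgp hg, ← hL.tsum_eq, (Aux.hasSum_split M hL.summable).2,
      Finset.sum_sub_distrib]
    simp only [tsum_mul_left]
    rw [← Finset.mul_sum]
    push_cast
    field_simp
  rw [hdiff, norm_mul, Complex.norm_real, Real.norm_of_nonneg (by positivity)]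
  set h : ℝ := (1 / 2 + (M : ℝ)) ^ (-s) with hh
  have hM' : (1:ℝ) ≤ M := by exact_mod_cast hM
  have hh0 : 0 ≤ h := by positivity
  have hh1 : h ≤ 1 := Real.rpow_le_one_of_one_le_of_nonpos (by linarith) (by linarith)
  have hC : 0 ≤ Cs s := Real.sqrt_nonneg _
  have hcl : ∀ r : Fin (2 * M + 1),
      ‖(∑' l, fCoeff f (Aux.idx M r l) * (starRingEnd ℂ) (fCoeff g (Aux.idx M r l))) -
        (∑' l, fCoeff f (Aux.idx M r l)) * (starRingEnd ℂ) (∑' l, fCoeff g (Aux.idx M r l))‖ ≤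
      (2 * Cs s + Cs s ^ 2) * h * (Real.sqrt (Aux.cn M s (fCoeff f) r) *
        Real.sqrt (Aux.cn M s (fCoeff g) r)) := by
    intro r
    obtain ⟨sa, a1, a2⟩ := Aux.class_bound M hM hs _ hfs' r
    obtain ⟨sb, b1, b2⟩ := Aux.class_bound M hM hs _ hgs' r
    refine (Aux.diag_bound sa sb).trans ?_
    rw [← hh] at a2 b2
    set A := Real.sqrt (Aux.cn M s (fCoeff f) r)
    set B := Real.sqrt (Aux.cn M s (fCoeff g) r)
    set x := ‖fCoeff f (Aux.idx M r 0)‖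
    set y := ‖fCoeff g (Aux.idx M r 0)‖
    have hx : 0 ≤ x := norm_nonneg _
    have hy : 0 ≤ y := norm_nonneg _
    have hA : 0 ≤ A := Real.sqrt_nonneg _
    have hB : 0 ≤ B := Real.sqrt_nonneg _
    have hhC : 0 ≤ h * Cs s := by positivity
    calc _ ≤ (x + h * Cs s * A) * (y + h * Cs s * B) - x * y := by
          gcongr
      _ = h * Cs s * (x * B) + h * Cs s * (A * y) + h * Cs s ^ 2 * (h * (A * B)) := by ring
      _ ≤ h * Cs s * (A * B) + h * Cs s * (A * B) + h * Cs s ^ 2 * (1 * (A * B)) := by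
          gcongr
      _ = _ := by ring
  have hnorm : ∀ a : ℝ → ℂ, (Summable fun n : ℤ => Aux.wt n ^ (2 * s) * ‖fCoeff a n‖ ^ 2) →
      sobNorm s a = Real.sqrt (2 * Real.pi) *
        Real.sqrt (∑ r : Fin (2 * M + 1), Aux.cn M s (fCoeff a) r) := by
    intro a ha
    rw [← Real.sqrt_mul (by positivity)]
    have := (Aux.hasSum_split M ha).2
    simp only [sobNorm, Aux.cn]
    rw [← this]
    rfl
  have hcn : ∀ (a : ℤ → ℂ) r, 0 ≤ Aux.cn M s a r := fun a r => tsum_nonneg fun l =>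
    mul_nonneg (Real.rpow_nonneg (Aux.wt_pos _).le _) (sq_nonneg _)
  have hCS := Real.sum_sqrt_mul_sqrt_le Finset.univ (hcn (fCoeff f)) (hcn (fCoeff g))
  rw [hnorm f hfs', hnorm g hgs']
  set SA := Real.sqrt (∑ r : Fin (2 * M + 1), Aux.cn M s (fCoeff f) r)
  set SB := Real.sqrt (∑ r : Fin (2 * M + 1), Aux.cn M s (fCoeff g) r)
  calc _ ≤ 2 * Real.pi * ∑ r : Fin (2 * M + 1), (2 * Cs s + Cs s ^ 2) * h *
        (Real.sqrt (Aux.cn M s (fCoeff f) r) * Real.sqrt (Aux.cn M s (fCoeff g) r)) := by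
        gcongr
        exact (norm_sum_le _ _).trans (Finset.sum_le_sum fun r _ => hcl r)
    _ ≤ 2 * Real.pi * ((2 * Cs s + Cs s ^ 2) * h * (SA * SB)) := by
        rw [← Finset.mul_sum]
        gcongr
    _ = (Real.sqrt (2 * Real.pi) * Real.sqrt (2 * Real.pi)) *
        ((2 * Cs s + Cs s ^ 2) * h * (SA * SB)) := by
        rw [Real.mul_self_sqrt (by positivity)]
    _ = _ := by ring
end

section
/- Let s > 1/2 and let f, g : ℝ → ℂ be continuous 2π-periodic functions with ‖f‖_s < ∞, ‖g‖_s < ∞, and vanishing means f̂(0) = 0 and ĝ(0) = 0. Set μ := (1/(2M+1)) Σ_{|m|≤M} f(θ_m). Then |⟨f,g⟩_{L²} − (2π/(2M+1)) Σ_{|m|≤M} (f(θ_m) − μ) · conj(g(θ_m))| ≤ (1 + √2 · C_s)(2 C_s + C_s²)(1/2 + M)^{−s} ‖f‖_s ‖g‖_s. -/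
open Complex Real

lemma aux_cs {ι : Type*} (f g : ι → ℝ) (hf : ∀ i, 0 ≤ f i) (hg : ∀ i, 0 ≤ g i)
    (hfs : Summable fun i => f i ^ 2) (hgs : Summable fun i => g i ^ 2) :
    (Summable fun i => f i * g i) ∧
      ∑' i, f i * g i ≤ √(∑' i, f i ^ 2) * √(∑' i, g i ^ 2) := by
  have h := Real.summable_and_inner_le_Lp_mul_Lq_tsum_of_nonneg
    (p := 2) (q := 2) (f := f) (g := g) Real.HolderConjugate.two_two hf hg
    (by simpa using hfs) (by simpa using hgs)
  refine ⟨h.1, ?_⟩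
  simpa [Real.sqrt_eq_rpow] using h.2

/-- weighted Cauchy-Schwarz -/
lemma aux_wcs {ι : Type*} (x p q : ι → ℝ) (c : ℝ) (hc : 0 ≤ c) (hx : ∀ i, 0 ≤ x i)
    (y : ι → ℝ)
    (hp : ∀ i, 0 ≤ p i) (hq : ∀ i, 0 ≤ q i) (hps : Summable p)
    (hqs : Summable fun i => q i * y i ^ 2) (hy : ∀ i, 0 ≤ y i)
    (h : ∀ i, x i ≤ c * (√(p i) * (√(q i) * y i))) :
    Summable x ∧ ∑' i, x i ≤ c * (√(∑' i, p i) * √(∑' i, q i * y i ^ 2)) := by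
  have key := aux_cs (fun i => √(p i)) (fun i => √(q i) * y i) (fun i => by positivity)
    (fun i => mul_nonneg (by positivity) (hy i))
    (by simpa [Real.sq_sqrt (hp _)] using hps)
    (by simpa [mul_pow, Real.sq_sqrt (hq _)] using hqs)
  simp only [mul_pow, Real.sq_sqrt (hp _), Real.sq_sqrt (hq _)] at key
  have hs := Summable.of_nonneg_of_le hx h (key.1.mul_left c)
  refine ⟨hs, (hs.tsum_le_tsum h (key.1.mul_left c)).trans ?_⟩
  rw [tsum_mul_left]
  exact mul_le_mul_of_nonneg_left key.2 hc

lemma aux_one_le_sqrt {ε t : ℝ} (hε : 0 ≤ ε) (h : 1 ≤ ε ^ 2 * t) : 1 ≤ ε * √t := by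
  have := Real.sqrt_le_sqrt h
  rwa [Real.sqrt_one, Real.sqrt_mul (by positivity), Real.sqrt_sq hε] at this

lemma aux_tail (a : ℤ → ℂ) (q r : ℤ → ℝ) (ε K : ℝ) (hε : 0 ≤ ε) (hK : 0 ≤ K)
    (hr : ∀ k, 0 ≤ r k) (hrs : Summable r) (hrK : ∑' k, r k ≤ K ^ 2) (hq : ∀ k, 0 ≤ q k)
    (hqr : ∀ k, k ≠ 0 → 1 ≤ ε ^ 2 * (r k * q k))
    (ha : Summable fun k => q k * ‖a k‖ ^ 2) :
    Summable a ∧ ‖∑' k, (if k = 0 then 0 else a k)‖ ≤ ε * (K * √(∑' k, q k * ‖a k‖ ^ 2)) := by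
  have h := aux_wcs (fun k => ‖if k = 0 then 0 else a k‖) r q ε hε (fun _ => norm_nonneg _)
    (fun k => ‖a k‖) hr hq hrs ha (fun _ => norm_nonneg _) (by
      intro k
      by_cases hk : k = 0
      · simp only [hk, if_true, norm_zero]; positivity
      · simp only [hk, if_false]
        have := aux_one_le_sqrt hε (hqr k hk)
        rw [Real.sqrt_mul (hr k)] at this
        nlinarith [norm_nonneg (a k)])
  constructor
  · have h2 : Summable (fun k => if k = 0 then 0 else a k) := h.1.of_norm
    have h3 : Summable (fun k => if k = 0 then a k else 0) :=
      summable_of_ne_finset_zero (s := {0}) (by intro b hb; simp at hb; simp [hb])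
    refine (h2.add h3).congr ?_
    intro k; by_cases hk : k = 0 <;> simp [hk]
  · refine (norm_tsum_le_tsum_norm h.1).trans (h.2.trans ?_)
    gcongr
    exact Real.sqrt_le_iff.2 ⟨hK, hrK⟩

lemma aux_prod (a b : ℤ → ℂ) (q : ℤ → ℝ) (ε : ℝ) (hε : 0 ≤ ε)
    (hq1 : ∀ k, 0 ≤ q k)
    (hq : ∀ k, k ≠ 0 → 1 ≤ ε ^ 2 * q k)
    (ha : Summable fun k => q k * ‖a k‖ ^ 2) (hb : Summable fun k => q k * ‖b k‖ ^ 2) :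
    ‖∑' k, (if k = 0 then 0 else a k * (starRingEnd ℂ) (b k))‖ ≤
      ε ^ 2 * (√(∑' k, q k * ‖a k‖ ^ 2) * √(∑' k, q k * ‖b k‖ ^ 2)) := by
  have h := aux_wcs (fun k => ‖if k = 0 then 0 else a k * (starRingEnd ℂ) (b k)‖)
    (fun k => q k * ‖a k‖ ^ 2) q (ε ^ 2) (by positivity) (fun _ => norm_nonneg _)
    (fun k => ‖b k‖) (fun k => mul_nonneg (hq1 k) (by positivity)) hq1 ha hb
    (fun _ => norm_nonneg _) (by
      intro k
      by_cases hk : k = 0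
      · simp only [hk, if_true, norm_zero]; positivity
      · simp only [hk, if_false, norm_mul, RCLike.norm_conj]
        rw [Real.sqrt_mul (hq1 k), Real.sqrt_sq (norm_nonneg _)]
        have e : ε ^ 2 * (√(q k) * ‖a k‖ * (√(q k) * ‖b k‖)) =
          (ε ^ 2 * (√(q k)) ^ 2) * (‖a k‖ * ‖b k‖) := by ring
        rw [e, Real.sq_sqrt (hq1 k)]
        exact le_mul_of_one_le_left (by positivity) (hq k hk))
  exact (norm_tsum_le_tsum_norm h.1).trans h.2

lemma aux_perj (a b : ℤ → ℂ) (q r : ℤ → ℝ) (ε K : ℝ) (hε : 0 ≤ ε) (hε1 : ε ≤ 1) (hK : 0 ≤ K)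
    (hr : ∀ k, 0 ≤ r k) (hr1 : ∀ k, r k ≤ 1) (hrs : Summable r) (hrK : ∑' k, r k ≤ K ^ 2)
    (hq : ∀ k, 1 ≤ q k) (hqr : ∀ k, k ≠ 0 → 1 ≤ ε ^ 2 * (r k * q k))
    (ha : Summable fun k => q k * ‖a k‖ ^ 2) (hb : Summable fun k => q k * ‖b k‖ ^ 2)
    (hab : Summable fun k => a k * (starRingEnd ℂ) (b k)) :
    ‖∑' k, a k * (starRingEnd ℂ) (b k) - (∑' k, a k) * (starRingEnd ℂ) (∑' k, b k)‖ ≤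
      ε * (1 + K) ^ 2 * (√(∑' k, q k * ‖a k‖ ^ 2) * √(∑' k, q k * ‖b k‖ ^ 2)) ∧
    (a 0 = 0 → ‖∑' k, a k * (starRingEnd ℂ) (b k)‖ ≤
      ε * (1 + K) ^ 2 * (√(∑' k, q k * ‖a k‖ ^ 2) * √(∑' k, q k * ‖b k‖ ^ 2))) := by
  have hq0 : ∀ k, 0 ≤ q k := fun k => zero_le_one.trans (hq k)
  obtain ⟨hsa, hta⟩ := aux_tail a q r ε K hε hK hr hrs hrK hq0 hqr ha
  obtain ⟨hsb, htb⟩ := aux_tail b q r ε K hε hK hr hrs hrK hq0 hqr hb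
  have hp := aux_prod a b q ε hε hq0 (fun k hk => (hqr k hk).trans (by
    have := mul_le_of_le_one_left (hq0 k) (hr1 k)
    gcongr)) ha hb
  have h0 : ∀ c : ℤ → ℂ, (Summable fun k => q k * ‖c k‖ ^ 2) →
      ‖c 0‖ ≤ √(∑' k, q k * ‖c k‖ ^ 2) := by
    intro c hc
    apply Real.le_sqrt_of_sq_le
    refine le_trans ?_ (hc.le_tsum 0 (fun k _ => mul_nonneg (hq0 k) (by positivity)))
    exact le_mul_of_one_le_left (by positivity) (hq 0)
  have h0a := h0 a ha
  have h0b := h0 b hb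
  rw [hsa.tsum_eq_add_tsum_ite 0, hsb.tsum_eq_add_tsum_ite 0, hab.tsum_eq_add_tsum_ite 0]
  set P := ∑' k, (if k = 0 then 0 else a k * (starRingEnd ℂ) (b k))
  set α := ∑' k, (if k = 0 then 0 else a k)
  set β := ∑' k, (if k = 0 then 0 else b k)
  set F := √(∑' k, q k * ‖a k‖ ^ 2)
  set G := √(∑' k, q k * ‖b k‖ ^ 2)
  have hF : 0 ≤ F := Real.sqrt_nonneg _
  have hG : 0 ≤ G := Real.sqrt_nonneg _
  have hFG : 0 ≤ F * G := by positivity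
  have hε2 : ε ^ 2 ≤ ε := by nlinarith
  have hP : ‖P‖ ≤ ε * (F * G) := hp.trans (by gcongr)
  refine ⟨?_, fun ha0 => ?_⟩
  · have e : a 0 * (starRingEnd ℂ) (b 0) + P - (a 0 + α) * (starRingEnd ℂ) (b 0 + β) =
      P - (a 0 * (starRingEnd ℂ) β + α * (starRingEnd ℂ) (b 0) + α * (starRingEnd ℂ) β) := by
      rw [map_add]; ring
    rw [e]
    refine (norm_sub_le _ _).trans ?_
    have h1 : ‖a 0 * (starRingEnd ℂ) β‖ ≤ F * (ε * (K * G)) := by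
      rw [norm_mul, RCLike.norm_conj]; gcongr
    have h2 : ‖α * (starRingEnd ℂ) (b 0)‖ ≤ ε * (K * F) * G := by
      rw [norm_mul, RCLike.norm_conj]; gcongr
    have h3 : ‖α * (starRingEnd ℂ) β‖ ≤ ε * (K * F) * (K * G) := by
      rw [norm_mul, RCLike.norm_conj]
      have : ε * (K * G) ≤ K * G := mul_le_of_le_one_left (by positivity) hε1
      gcongr
      exact htb.trans this
    have h4 := norm_add₃_le (a := a 0 * (starRingEnd ℂ) β) (b := α * (starRingEnd ℂ) (b 0))
      (c := α * (starRingEnd ℂ) β)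
    nlinarith
  · rw [ha0]
    simp only [zero_mul, zero_add]
    refine hP.trans ?_
    have : (1:ℝ) ≤ (1 + K) ^ 2 := by nlinarith
    have h5 : 0 ≤ ε * (F * G) := by positivity
    nlinarith

lemma aux_regroup {E : Type*} [NormedAddCommGroup E] [CompleteSpace E] (M : ℕ) (h : ℤ → E)
    (hs : Summable h) :
    (∀ j : ℤ, Summable fun k : ℤ => h (j + k * (2 * M + 1))) ∧
    ∑' n, h n = ∑ j ∈ Finset.Icc (-(M : ℤ)) (M : ℤ), ∑' k : ℤ, h (j + k * (2 * M + 1)) := by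
  have hN : (0 : ℤ) < 2 * M + 1 := by positivity
  constructor
  · intro j
    refine hs.comp_injective (i := fun k : ℤ => j + k * (2 * (M : ℤ) + 1)) ?_
    intro k k' hk
    have : k * (2 * (M : ℤ) + 1) = k' * (2 * (M : ℤ) + 1) := by simpa using hk
    exact mul_right_cancel₀ hN.ne' this
  · have hbij : Function.Bijective
      (fun p : (Finset.Icc (-(M : ℤ)) (M : ℤ)) × ℤ => (p.1 : ℤ) + p.2 * (2 * M + 1)) := by
      constructor
      · rintro ⟨⟨j, hj⟩, k⟩ ⟨⟨j', hj'⟩, k'⟩ hh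
        simp only [Finset.mem_Icc] at hj hj' hh
        have hk : k = k' := by
          have h1 : (k - k') * (2 * (M : ℤ) + 1) = j' - j := by linarith
          by_contra hne
          rcases lt_or_gt_of_ne hne with hlt | hlt
          · nlinarith
          · nlinarith
        subst hk
        have : j = j' := by linarith
        subst this
        rfl
      · intro n
        have h1 := Int.emod_nonneg (n + M) hN.ne'
        have h2 := Int.emod_lt_of_pos (n + M) hN
        have h3 := Int.emod_add_mul_ediv (n + M) (2 * (M : ℤ) + 1)
        refine ⟨(⟨(n + M) % (2 * M + 1) - M, Finset.mem_Icc.2 ⟨by linarith, by linarith⟩⟩,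
          (n + M) / (2 * M + 1)), ?_⟩
        simp only
        linarith
    rw [← (Equiv.ofBijective _ hbij).tsum_eq h]
    rw [Summable.tsum_prod (f := fun c => h ((Equiv.ofBijective _ hbij) c))
      ((Equiv.ofBijective _ hbij).summable_iff.2 hs), tsum_fintype]
    exact Finset.sum_coe_sort (Finset.Icc (-(M : ℤ)) (M : ℤ))
      (fun j => ∑' k : ℤ, h (j + k * (2 * M + 1)))

lemma aux_fourier (f : ℝ → ℂ) (hfc : Continuous f) (hfp : Function.Periodic f (2 * Real.pi))
    (hs : Summable (fCoeff f)) (x : ℝ) :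
    HasSum (fun n : ℤ => fCoeff f n * Complex.exp (Complex.I * n * x)) (f x) := by
  have : Fact (0 < 2 * Real.pi) := ⟨Real.two_pi_pos⟩
  have hpi : (Real.pi : ℂ) ≠ 0 := by exact_mod_cast Real.pi_ne_zero
  let F : C(AddCircle (2 * Real.pi), ℂ) := ⟨hfp.lift, by
    apply continuous_coinduced_dom.mpr
    exact hfc⟩
  have hFx : ∀ x : ℝ, F (x : AddCircle (2 * Real.pi)) = f x := fun x => rfl
  have hfour : ∀ (n : ℤ) (x : ℝ), fourier n (x : AddCircle (2 * Real.pi)) =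
      Complex.exp (Complex.I * n * x) := by
    intro n x
    rw [fourier_coe_apply]
    congr 1
    push_cast
    field_simp
  have hco : fourierCoeff F = fCoeff f := by
    funext n
    rw [fourierCoeff_eq_intervalIntegral F n (-Real.pi), fCoeff]
    have e : -Real.pi + 2 * Real.pi = Real.pi := by ring
    rw [e, Complex.real_smul]
    congr 1
    · push_cast; rfl
    · apply intervalIntegral.integral_congr
      intro y _
      simp only [hfour, hFx, smul_eq_mul]
      rw [mul_comm]
      congr 2
      push_cast; ring
  have h := has_pointwise_sum_fourier_series_of_summable (f := F) (by rw [hco]; exact hs)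
    (x : AddCircle (2 * Real.pi))
  rw [hco] at h
  simpa only [hfour, hFx, smul_eq_mul] using h

lemma aux_parseval (f g : ℝ → ℂ) (hfc : Continuous f) (hfp : Function.Periodic f (2 * Real.pi))
    (hs : Summable (fCoeff f)) (hgc : Continuous g) :
    HasSum (fun n : ℤ => (2 * Real.pi : ℂ) * (fCoeff f n * (starRingEnd ℂ) (fCoeff g n)))
      (L2inner f g) := by
  have hpi : (Real.pi : ℂ) ≠ 0 := by exact_mod_cast Real.pi_ne_zero
  have h := intervalIntegral.hasSum_integral_of_dominated_convergence
    (μ := MeasureTheory.volume) (a := -Real.pi) (b := Real.pi)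
    (F := fun (n : ℤ) (x : ℝ) =>
      fCoeff f n * Complex.exp (Complex.I * n * x) * (starRingEnd ℂ) (g x))
    (f := fun x => f x * (starRingEnd ℂ) (g x))
    (fun n x => ‖fCoeff f n‖ * ‖g x‖)
    (fun n => by
      apply Continuous.aestronglyMeasurable
      have : Continuous fun x => (starRingEnd ℂ) (g x) := Complex.continuous_conj.comp hgc
      fun_prop)
    (fun n => by
      refine Filter.Eventually.of_forall fun x _ => ?_
      rw [norm_mul, norm_mul, RCLike.norm_conj]
      have : ‖Complex.exp (Complex.I * n * x)‖ = 1 := by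
        rw [Complex.norm_exp]; simp
      rw [this, mul_one])
    (Filter.Eventually.of_forall fun x _ => hs.norm.mul_right _)
    (by
      simp only [tsum_mul_right]
      apply Continuous.intervalIntegrable
      fun_prop)
    (Filter.Eventually.of_forall fun x _ => (aux_fourier f hfc hfp hs x).mul_right _)
  unfold L2inner
  refine h.congr_fun ?_ |> fun h => h
  intro n
  simp only [mul_assoc]
  rw [intervalIntegral.integral_const_mul]
  have e : (starRingEnd ℂ) (fCoeff g n) = (1 / (2 * (Real.pi : ℂ))) *
    ∫ θ in (-Real.pi)..Real.pi, Complex.exp (Complex.I * (n * (θ : ℂ))) * (starRingEnd ℂ) (g θ) := by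
    rw [fCoeff, map_mul, intervalIntegral.integral_of_le (by linarith [Real.pi_pos]),
      ← integral_conj, ← intervalIntegral.integral_of_le (by linarith [Real.pi_pos])]
    congr 1
    · simp [Complex.conj_ofNat]
    · apply intervalIntegral.integral_congr
      intro y _
      simp only [map_mul, ← Complex.exp_conj, map_neg, Complex.conj_I, Complex.conj_ofReal,
        map_intCast]
      rw [mul_comm]
      congr 2
      ring
  rw [e]
  field_simp

lemma aux_orth (M : ℕ) (l : ℤ) (hl : |l| ≤ 2 * M) :
    ∑ m ∈ Finset.Icc (-(M : ℤ)) (M : ℤ), Complex.exp (Complex.I * l * theta M m) =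
      if l = 0 then (2 * (M : ℂ) + 1) else 0 := by
  split_ifs with h0
  · subst h0
    have hc : (Finset.Icc (-(M : ℤ)) (M : ℤ)).card = 2 * M + 1 := by
      rw [Int.card_Icc]; omega
    simp only [Int.cast_zero, mul_zero, zero_mul, Complex.exp_zero, Finset.sum_const, hc]
    simp
  · have hN : (2 * (M : ℂ) + 1) ≠ 0 := by exact_mod_cast (by positivity : (2 * M + 1) ≠ 0)
    set z : ℂ := Complex.exp (2 * Real.pi * Complex.I * l / (2 * M + 1)) with hz
    have hz0 : z ≠ 0 := Complex.exp_ne_zero _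
    have hzm : ∀ m : ℤ, Complex.exp (Complex.I * l * theta M m) = z ^ m := by
      intro m
      rw [hz, ← Complex.exp_int_mul]
      congr 1
      simp only [theta]
      push_cast
      ring
    have hzN : z ^ (2 * M + 1) = 1 := by
      rw [hz, ← Complex.exp_nat_mul, Complex.exp_eq_one_iff]
      refine ⟨l, ?_⟩
      push_cast
      field_simp
    have hz1 : z ≠ 1 := by
      rw [hz, Ne, Complex.exp_eq_one_iff]
      rintro ⟨n, hn⟩
      have hpi : (Real.pi : ℂ) ≠ 0 := by exact_mod_cast Real.pi_ne_zero
      have hI := Complex.I_ne_zero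
      field_simp at hn
      have hn' : l = n * (2 * M + 1) := by
        have : (l : ℂ) = n * (2 * M + 1) := by linear_combination hn
        exact_mod_cast this
      have hn0 : n ≠ 0 := by rintro rfl; simp at hn'; exact h0 hn'
      have : 1 ≤ |n| := Int.one_le_abs hn0
      rw [hn', abs_mul, abs_of_pos (by positivity : (0 : ℤ) < 2 * M + 1)] at hl
      nlinarith
    have hgs : ∑ i ∈ Finset.range (2 * M + 1), z ^ i = 0 := by
      have := geom_sum_mul z (2 * M + 1)
      rw [hzN, sub_self] at this
      exact (mul_eq_zero.1 this).resolve_right (sub_ne_zero.2 hz1)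
    have : ∑ m ∈ Finset.Icc (-(M : ℤ)) (M : ℤ), Complex.exp (Complex.I * l * theta M m) =
        ∑ i ∈ Finset.range (2 * M + 1), z ^ (-(M : ℤ)) * z ^ i := by
      refine Finset.sum_nbij' (fun m => (m + M).toNat) (fun i => (i : ℤ) - M) ?_ ?_ ?_ ?_ ?_
      · intro m hm; simp at hm ⊢; omega
      · intro m hm; simp at hm ⊢; omega
      · intro m hm; simp at hm ⊢; omega
      · intro m hm; simp
      · intro m hm
        simp at hm
        rw [hzm, ← zpow_natCast, ← zpow_add₀ hz0]
        congr 1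
        omega
    rw [this, ← Finset.mul_sum, hgs, mul_zero]

lemma aux_dft (M : ℕ) (A B : ℤ → ℂ) :
    (1 / (2 * (M : ℂ) + 1)) * ∑ m ∈ Finset.Icc (-(M : ℤ)) (M : ℤ),
      (∑ j ∈ Finset.Icc (-(M : ℤ)) (M : ℤ), A j * Complex.exp (Complex.I * j * theta M m)) *
      (starRingEnd ℂ)
        (∑ j ∈ Finset.Icc (-(M : ℤ)) (M : ℤ), B j * Complex.exp (Complex.I * j * theta M m)) =
    ∑ j ∈ Finset.Icc (-(M : ℤ)) (M : ℤ), A j * (starRingEnd ℂ) (B j) := by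
  have hN : (2 * (M : ℂ) + 1) ≠ 0 := by exact_mod_cast (by positivity : (2 * M + 1) ≠ 0)
  simp only [map_sum, Finset.sum_mul_sum, map_mul, ← Complex.exp_conj, Complex.conj_I,
    Complex.conj_ofReal, map_intCast]
  rw [Finset.sum_comm]
  rw [Finset.mul_sum]
  refine Finset.sum_congr rfl fun j hj => ?_
  rw [Finset.sum_comm]
  have : ∀ i ∈ Finset.Icc (-(M : ℤ)) (M : ℤ), ∑ m ∈ Finset.Icc (-(M : ℤ)) (M : ℤ),
      A j * Complex.exp (Complex.I * j * theta M m) *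
        ((starRingEnd ℂ) (B i) * Complex.exp (-Complex.I * i * theta M m)) =
      A j * (starRingEnd ℂ) (B i) * if j = i then (2 * (M : ℂ) + 1) else 0 := by
    intro i hi
    simp only [Finset.mem_Icc] at hi hj
    have h := aux_orth M (j - i) (abs_le.2 ⟨by linarith, by linarith⟩)
    simp only [sub_eq_zero] at h
    rw [← h, Finset.mul_sum]
    refine Finset.sum_congr rfl fun m _ => ?_
    have : Complex.exp (Complex.I * ((j - i : ℤ) : ℂ) * theta M m) =
      Complex.exp (Complex.I * j * theta M m) * Complex.exp (-Complex.I * i * theta M m) := by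
      rw [← Complex.exp_add]; congr 1; push_cast; ring
    rw [this]; ring
  rw [Finset.sum_congr rfl this]
  simp only [mul_ite, mul_zero]
  rw [Finset.sum_ite_eq, if_pos hj]
  field_simp

lemma aux_C (s : ℝ) (hs : 1 / 2 < s) :
    Summable (fun k : ℤ => (max 1 |(k : ℝ)|) ^ (-(2 * s))) ∧
    ∑' k : ℤ, (max 1 |(k : ℝ)|) ^ (-(2 * s)) ≤ 2 * Cs s ^ 2 ∧ 2 ≤ Cs s ^ 2 := by
  have h1 : Summable (fun n : ℕ => (max 1 (n : ℝ)) ^ (-(2 * s))) := by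
    have := (Real.summable_nat_rpow (p := -(2 * s))).2 (by linarith)
    rw [← summable_nat_add_iff 1] at this ⊢
    refine this.congr fun n => ?_
    have : (1 : ℝ) ≤ ((n + 1 : ℕ) : ℝ) := by push_cast; linarith [Nat.cast_nonneg (α := ℝ) n]
    rw [max_eq_right this]
  have hnn : ∀ n : ℕ, 0 ≤ (max 1 (n : ℝ)) ^ (-(2 * s)) := fun n => by positivity
  have hC : Cs s ^ 2 = ∑' n : ℕ, (max 1 (n : ℝ)) ^ (-(2 * s)) :=
    Real.sq_sqrt (tsum_nonneg hnn)
  have hz := HasSum.of_nat_of_neg (f := fun k : ℤ => (max 1 |(k : ℝ)|) ^ (-(2 * s)))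
    (by simpa using h1.hasSum) (by simpa using h1.hasSum)
  refine ⟨hz.summable, ?_, ?_⟩
  · rw [hz.tsum_eq, hC]
    simp
    linarith
  · rw [hC]
    have := h1.sum_le_tsum (Finset.range 2) (fun n _ => hnn n)
    simp [Finset.sum_range_succ] at this
    linarith

lemma aux_weight (M : ℕ) (s : ℝ) (hs : 1 / 2 < s) (j k : ℤ)
    (hj : j ∈ Finset.Icc (-(M : ℤ)) (M : ℤ)) (hk : k ≠ 0) :
    1 ≤ ((1 / 2 + (M : ℝ)) ^ (-s)) ^ 2 * ((max 1 |(k : ℝ)|) ^ (-(2 * s)) *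
      (max 1 |((j + k * (2 * M + 1) : ℤ) : ℝ)|) ^ (2 * s)) := by
  have hP : 0 < 1 / 2 + (M : ℝ) := by positivity
  have hk1 : (1 : ℝ) ≤ |(k : ℝ)| := by exact_mod_cast Int.one_le_abs hk
  have hj' : |(j : ℝ)| ≤ M := by
    rw [Finset.mem_Icc] at hj
    exact_mod_cast abs_le.2 hj
  have hle : (1 / 2 + (M : ℝ)) * max 1 |(k : ℝ)| ≤ max 1 |((j + k * (2 * M + 1) : ℤ) : ℝ)| := by
    refine le_trans ?_ (le_max_right _ _)
    rw [max_eq_right hk1]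
    push_cast
    have h1 := abs_sub_abs_le_abs_sub ((k : ℝ) * (2 * M + 1)) (-(j : ℝ))
    rw [abs_neg, abs_mul, abs_of_pos (by positivity : (0 : ℝ) < 2 * M + 1)] at h1
    have h2 : (k : ℝ) * (2 * M + 1) - -(j : ℝ) = j + k * (2 * M + 1) := by ring
    rw [h2] at h1
    nlinarith
  have h3 := Real.rpow_le_rpow (by positivity) hle (by linarith : 0 ≤ 2 * s)
  rw [Real.mul_rpow hP.le (by positivity)] at h3
  have e1 : ((1 / 2 + (M : ℝ)) ^ (-s)) ^ 2 = ((1 / 2 + (M : ℝ)) ^ (2 * s))⁻¹ := by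
    rw [← Real.rpow_natCast, ← Real.rpow_mul hP.le, ← Real.rpow_neg hP.le]
    congr 1; push_cast; ring
  rw [e1, Real.rpow_neg (by positivity)]
  have p1 : 0 < (1 / 2 + (M : ℝ)) ^ (2 * s) := by positivity
  have p2 : 0 < (max 1 |(k : ℝ)|) ^ (2 * s) := by positivity
  rw [← mul_assoc, ← mul_inv, inv_mul_eq_div, le_div_iff₀ (by positivity), one_mul]
  exact h3

lemma aux_nodes (M : ℕ) (f : ℝ → ℂ) (hfc : Continuous f)
    (hfp : Function.Periodic f (2 * Real.pi)) (hs : Summable (fCoeff f)) (m : ℤ) :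
    f (theta M m) = ∑ j ∈ Finset.Icc (-(M : ℤ)) (M : ℤ),
      (∑' k : ℤ, fCoeff f (j + k * (2 * M + 1))) * Complex.exp (Complex.I * j * theta M m) := by
  have h := aux_fourier f hfc hfp hs (theta M m)
  rw [← h.tsum_eq, (aux_regroup M _ h.summable).2]
  refine Finset.sum_congr rfl fun j _ => ?_
  rw [← tsum_mul_right]
  refine tsum_congr fun k => ?_
  congr 1
  have hN : (2 * (M : ℂ) + 1) ≠ 0 := by exact_mod_cast (by positivity : (2 * M + 1) ≠ 0)
  rw [Complex.exp_eq_exp_iff_exists_int]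
  refine ⟨k * m, ?_⟩
  simp only [theta]
  push_cast
  field_simp

/-- For `s > 1/2` and continuous 2π-periodic mean-free `f, g` with
finite `s`-Sobolev norms, with `μ = (1/(2M+1)) Σ_{|m|≤M} f(θ_m)`:
`|⟨f,g⟩_{L²} - (2π/(2M+1)) Σ (f(θ_m) - μ) conj(g(θ_m))|
  ≤ (1 + √2 C_s)(2C_s + C_s²)(1/2+M)^{-s} ‖f‖_s ‖g‖_s`. -/
theorem stmt_13 (M : ℕ) (hM : 1 ≤ M) (s : ℝ) (hs : 1 / 2 < s) (f g : ℝ → ℂ)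
    (hfc : Continuous f) (hfp : Function.Periodic f (2 * Real.pi)) (hfs : SobSummable s f)
    (hgc : Continuous g) (hgp : Function.Periodic g (2 * Real.pi)) (hgs : SobSummable s g)
    (hf0 : fCoeff f 0 = 0) (hg0 : fCoeff g 0 = 0) :
    ‖L2inner f g - ((2 * Real.pi / (2 * M + 1) : ℝ) : ℂ) *
        ∑ m ∈ Finset.Icc (-(M : ℤ)) (M : ℤ),
          (f (theta M m) - (1 / (2 * (M : ℂ) + 1)) *
              ∑ k ∈ Finset.Icc (-(M : ℤ)) (M : ℤ), f (theta M k)) *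
            (starRingEnd ℂ) (g (theta M m))‖ ≤
      (1 + Real.sqrt 2 * Cs s) * (2 * Cs s + Cs s ^ 2) * (1 / 2 + (M : ℝ)) ^ (-s) *
        sobNorm s f * sobNorm s g := by
  obtain ⟨hWs, hWC, hC2⟩ := aux_C s hs
  have hC0 : 0 ≤ Cs s := Real.sqrt_nonneg _
  set K := √2 * Cs s with hKdef
  have hK0 : 0 ≤ K := by positivity
  have hK2 : K ^ 2 = 2 * Cs s ^ 2 := by rw [hKdef, mul_pow, Real.sq_sqrt (by norm_num)]
  set ε := (1 / 2 + (M : ℝ)) ^ (-s) with hεdef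
  have hε0 : 0 ≤ ε := by positivity
  have hM1 : (1 : ℝ) ≤ M := by exact_mod_cast hM
  have hε1 : ε ≤ 1 := Real.rpow_le_one_of_one_le_of_nonpos (by linarith) (by linarith)
  have hsum : ∀ u : ℝ → ℂ, SobSummable s u → Summable (fCoeff u) := by
    intro u hu
    refine (aux_tail (fCoeff u) (fun k : ℤ => (max 1 |(k : ℝ)|) ^ (2 * s))
      (fun k : ℤ => (max 1 |(k : ℝ)|) ^ (-(2 * s))) 1 K zero_le_one hK0 (fun k => by positivity)
      hWs (by rw [hK2]; exact hWC) (fun k => by positivity) (fun k _ => ?_) hu).1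
    rw [← Real.rpow_add (by positivity)]
    simp
  have hfS := hsum f hfs
  have hgS := hsum g hgs
  have hpar := aux_parseval f g hfc hfp hfS hgc
  have hpi : (2 * Real.pi : ℂ) ≠ 0 := by
    exact_mod_cast (by positivity : (2 * Real.pi) ≠ 0)
  have hab : Summable fun n : ℤ => fCoeff f n * (starRingEnd ℂ) (fCoeff g n) :=
    (summable_mul_left_iff hpi).1 hpar.summable
  set A : ℤ → ℂ := fun j => ∑' k : ℤ, fCoeff f (j + k * (2 * M + 1)) with hA
  set B : ℤ → ℂ := fun j => ∑' k : ℤ, fCoeff g (j + k * (2 * M + 1)) with hB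
  have hfn : ∀ m, f (theta M m) = ∑ j ∈ Finset.Icc (-(M : ℤ)) (M : ℤ),
      A j * Complex.exp (Complex.I * j * theta M m) := fun m => aux_nodes M f hfc hfp hfS m
  have hgn : ∀ m, g (theta M m) = ∑ j ∈ Finset.Icc (-(M : ℤ)) (M : ℤ),
      B j * Complex.exp (Complex.I * j * theta M m) := fun m => aux_nodes M g hgc hgp hgS m
  have h0mem : (0 : ℤ) ∈ Finset.Icc (-(M : ℤ)) (M : ℤ) := by simp
  have hμ : (1 / (2 * (M : ℂ) + 1)) * ∑ k ∈ Finset.Icc (-(M : ℤ)) (M : ℤ), f (theta M k) = A 0 := by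
    have h := aux_dft M A (fun j => if j = 0 then 1 else 0)
    simp only [ite_mul, one_mul, zero_mul, Finset.sum_ite_eq', if_pos h0mem, apply_ite (starRingEnd ℂ),
      map_one, map_zero, mul_ite, mul_one, mul_zero, ← hfn, Int.cast_zero, Complex.exp_zero] at h
    exact h
  have hquad : ((2 * Real.pi / (2 * M + 1) : ℝ) : ℂ) *
        ∑ m ∈ Finset.Icc (-(M : ℤ)) (M : ℤ),
          (f (theta M m) - (1 / (2 * (M : ℂ) + 1)) *
              ∑ k ∈ Finset.Icc (-(M : ℤ)) (M : ℤ), f (theta M k)) *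
            (starRingEnd ℂ) (g (theta M m)) =
      (2 * Real.pi : ℂ) * ∑ j ∈ Finset.Icc (-(M : ℤ)) (M : ℤ),
        (if j = 0 then 0 else A j) * (starRingEnd ℂ) (B j) := by
    rw [hμ, ← aux_dft M (fun j => if j = 0 then 0 else A j) B, ← mul_assoc]
    congr 1
    · push_cast; ring
    · refine Finset.sum_congr rfl fun m _ => ?_
      rw [hgn m]
      congr 1
      rw [hfn m, ← Finset.add_sum_erase _ _ h0mem, ← Finset.add_sum_erase _ _ h0mem]
      simp only [Int.cast_zero, mul_zero, zero_mul, Complex.exp_zero, mul_one, if_true]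
      rw [add_sub_cancel_left, zero_add]
      refine Finset.sum_congr rfl fun j hj => ?_
      rw [if_neg (Finset.ne_of_mem_erase hj)]
  have hL : L2inner f g = (2 * Real.pi : ℂ) * ∑ j ∈ Finset.Icc (-(M : ℤ)) (M : ℤ),
      ∑' k : ℤ, fCoeff f (j + k * (2 * M + 1)) *
        (starRingEnd ℂ) (fCoeff g (j + k * (2 * M + 1))) := by
    rw [← hpar.tsum_eq, tsum_mul_left, (aux_regroup M _ hab).2]
  rw [hquad, hL, ← mul_sub, ← Finset.sum_sub_distrib, norm_mul]
  let Fj : (ℝ → ℂ) → ℤ → ℝ := fun u j => ∑' k : ℤ,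
    (max 1 |((j + k * (2 * M + 1) : ℤ) : ℝ)|) ^ (2 * s) * ‖fCoeff u (j + k * (2 * M + 1))‖ ^ 2
  have hFj0 : ∀ u j, 0 ≤ Fj u j := fun u j => tsum_nonneg fun k => by positivity
  have hbound : ∀ j ∈ Finset.Icc (-(M : ℤ)) (M : ℤ),
      ‖∑' k : ℤ, fCoeff f (j + k * (2 * M + 1)) *
        (starRingEnd ℂ) (fCoeff g (j + k * (2 * M + 1))) -
        (if j = 0 then 0 else A j) * (starRingEnd ℂ) (B j)‖ ≤
      ε * (1 + K) ^ 2 * (√(Fj f j) * √(Fj g j)) := by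
    intro j hj
    have h := aux_perj (fun k : ℤ => fCoeff f (j + k * (2 * M + 1)))
      (fun k : ℤ => fCoeff g (j + k * (2 * M + 1)))
      (fun k : ℤ => (max 1 |((j + k * (2 * M + 1) : ℤ) : ℝ)|) ^ (2 * s))
      (fun k : ℤ => (max 1 |(k : ℝ)|) ^ (-(2 * s))) ε K hε0 hε1 hK0 (fun k => by positivity)
      (fun k => Real.rpow_le_one_of_one_le_of_nonpos (le_max_left _ _) (by linarith)) hWs
      (by rw [hK2]; exact hWC)
      (fun k => Real.one_le_rpow (le_max_left _ _) (by linarith))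
      (fun k hk => aux_weight M s hs j k hj hk)
      ((aux_regroup M _ hfs).1 j) ((aux_regroup M _ hgs).1 j) ((aux_regroup M _ hab).1 j)
    by_cases hj0 : j = 0
    · rw [if_pos hj0, zero_mul, sub_zero]
      exact h.2 (by simp [hj0, hf0])
    · rw [if_neg hj0]
      exact h.1
  have hcs := Real.sum_sqrt_mul_sqrt_le (Finset.Icc (-(M : ℤ)) (M : ℤ)) (hFj0 f) (hFj0 g)
  have hFs : ∀ u, SobSummable s u → sobNorm s u =
      √(2 * Real.pi) * √(∑ j ∈ Finset.Icc (-(M : ℤ)) (M : ℤ), Fj u j) := by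
    intro u hu
    rw [sobNorm, (aux_regroup M _ hu).2, Real.sqrt_mul (by positivity)]
  have hsumle := (norm_sum_le _ _).trans (Finset.sum_le_sum hbound)
  rw [← Finset.mul_sum] at hsumle
  have hsumle2 := hsumle.trans (mul_le_mul_of_nonneg_left hcs (by positivity))
  rw [hFs f hfs, hFs g hgs]
  have hn : ‖(2 * Real.pi : ℂ)‖ = √(2 * Real.pi) * √(2 * Real.pi) := by
    rw [Real.mul_self_sqrt (by positivity)]
    simp [abs_of_pos Real.pi_pos]
  rw [hn]
  set X := √(∑ j ∈ Finset.Icc (-(M : ℤ)) (M : ℤ), Fj f j)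
  set Y := √(∑ j ∈ Finset.Icc (-(M : ℤ)) (M : ℤ), Fj g j)
  set p := √(2 * Real.pi)
  have hconst : (1 + K) ^ 2 ≤ (1 + K) * (2 * Cs s + Cs s ^ 2) := by
    rw [sq]
    refine mul_le_mul_of_nonneg_left ?_ (by positivity)
    have : K ≤ 2 * Cs s := by
      rw [hKdef]
      refine mul_le_mul_of_nonneg_right ?_ hC0
      exact Real.sqrt_le_iff.2 ⟨by norm_num, by norm_num⟩
    linarith
  have hX : 0 ≤ X := Real.sqrt_nonneg _
  have hY : 0 ≤ Y := Real.sqrt_nonneg _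
  have hp : 0 ≤ p := Real.sqrt_nonneg _
  calc _ ≤ p * p * (ε * (1 + K) ^ 2 * (X * Y)) := by gcongr
    _ ≤ p * p * (ε * ((1 + K) * (2 * Cs s + Cs s ^ 2)) * (X * Y)) := by gcongr
    _ = _ := by ring
end
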